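/- Let μ, l ≥ 1, s ≥ 0, 1 ≤ ρ ≤ μ, m ≥ 1 with gcd(m, μ+1) = 1, and fix 0 ≤ k ≤ l−1. Let λ = Λ(μ,s,l,ρ,m), λ^{(k)} = λ − ε(ρ+kμ), L = ρ+lμ, N = (s+l+1)μ+s+ρ, and M = L + |λ^{(k)}|. Then there exists exactly one β ∈ ℕ₀^M such that (λ^{(k)}, β) is a (−m/(μ+1))-critical pair. This β satisfies ℓ(β) = N+l−k > N and is given explicitly by: β_i = λ_i for all i ≤ ρ+kμ−1; β_{ρ+kμ} = m−1; β_i = 0 for ρ+kμ+1 ≤ i ≤ ρ+(k+1)μ; β_i = λ_i + m for ρ+(k+1)μ+1 ≤ i ≤ L; β_i = m for L+1 ≤ i ≤ N+l−k; and β_i = 0 for i > N+l−k. -/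

import Mathlib

open Finset

/-- The partition `Λ(μ,s,l,ρ,m)` as a 1-based function, padded with zeros:
`ρ` parts equal to `m(s+l+1)` followed by, for `i = l, l-1, …, 1`, `μ` parts
equal to `m(s+i)`. -/
def Lam1 (μ s l ρ m : ℕ) : ℕ → ℕ := fun i =>
  if i = 0 then 0
  else if i ≤ ρ then m * (s + l + 1)
  else if i ≤ ρ + l * μ then m * (s + l - (i - ρ - 1) / μ)
  else 0

/-- `λ = Λ(μ,s,l,ρ,m) - ε(ρ+kμ)`: subtract 1 from part number `ρ+kμ` (1-based). -/
def lamK (μ s l ρ m k : ℕ) : ℕ → ℕ := fun i =>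
  if i = ρ + k * μ then Lam1 μ s l ρ m i - 1 else Lam1 μ s l ρ m i

/-- The rank `r(α,i) = #{j : α_j > α_i} + #{j : 1 ≤ j ≤ i, α_j = α_i}` of a
composition `α ∈ ℕ₀^M` (1-based). -/
def rank (M : ℕ) (α : ℕ → ℕ) (i : ℕ) : ℕ :=
  ((Finset.Icc 1 M).filter fun j => α i < α j).card +
  ((Finset.Icc 1 i).filter fun j => α j = α i).card

/-- partial sum `Σ_{i=1}^{j} α_i`. -/
def psum (α : ℕ → ℕ) (j : ℕ) : ℕ := ∑ i ∈ Finset.Icc 1 j, α i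

/-- `ℓ(α) = max{j : α_j > 0}` for a composition in `ℕ₀^M`. -/
def lenOf (M : ℕ) (α : ℕ → ℕ) : ℕ := ((Finset.Icc 1 M).filter fun j => α j ≠ 0).sup id

/-- the decreasing rearrangement `α⁺` of `(α_1, …, α_M)`, as a 1-based function. -/
def decRe (M : ℕ) (α : ℕ → ℕ) : ℕ → ℕ := fun i =>
  (List.insertionSort (· ≥ ·) ((List.range M).map fun j => α (j + 1))).getD (i - 1) 0

/-- `α ⪰ β`: all partial sums of `α` dominate those of `β`. -/
def domsWeak (M : ℕ) (α β : ℕ → ℕ) : Prop :=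
  ∀ j ∈ Finset.Icc 1 M, psum β j ≤ psum α j

/-- `α ≻ β`: `α ≠ β` and all partial sums of `α` dominate those of `β`. -/
def doms (M : ℕ) (α β : ℕ → ℕ) : Prop :=
  (∃ i ∈ Finset.Icc 1 M, α i ≠ β i) ∧ domsWeak M α β

/-- `α ▷ β`: `|α| = |β|` and either `α⁺ ≻ β⁺`, or `α⁺ = β⁺` and `α ≻ β`. -/
def trig (M : ℕ) (α β : ℕ → ℕ) : Prop :=
  psum α M = psum β M ∧
  (doms M (decRe M α) (decRe M β) ∨
    ((∀ i ∈ Finset.Icc 1 M, decRe M α i = decRe M β i) ∧ doms M α β))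

/-- `α ⊵ β`: `α ▷ β` or `α = β`. -/
def trigeq (M : ℕ) (α β : ℕ → ℕ) : Prop :=
  trig M α β ∨ ∀ i ∈ Finset.Icc 1 M, α i = β i

/-- The cells `I_0 = [1,ρ]` and `I_j = [ρ+(j-1)μ+1, ρ+jμ]` for `j ≥ 1`. -/
def cellI (ρ μ : ℕ) (j : ℕ) : Finset ℕ :=
  if j = 0 then Finset.Icc 1 ρ else Finset.Icc (ρ + (j - 1) * μ + 1) (ρ + j * μ)

/-- `(α, β)` is a `(-m/n)`-critical pair of compositions in `ℕ₀^M`: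
`α ▷ β` and `n(α_i - β_i) = m(r(β,i) - r(α,i))` for every `1 ≤ i ≤ M`. -/
def isCriticalPair (M n m : ℕ) (α β : ℕ → ℕ) : Prop :=
  trig M α β ∧
  ∀ i ∈ Finset.Icc 1 M,
    (n : ℤ) * ((α i : ℤ) - (β i : ℤ)) =
      (m : ℤ) * ((rank M β i : ℤ) - (rank M α i : ℤ))

/-- The explicit composition `β` of STATEMENT 11. -/
def betaExp (μ s l ρ m k L N : ℕ) : ℕ → ℕ := fun i =>
  if i = 0 then 0
  else if i < ρ + k * μ then Lam1 μ s l ρ m i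
  else if i = ρ + k * μ then m - 1
  else if i ≤ ρ + (k + 1) * μ then 0
  else if i ≤ L then Lam1 μ s l ρ m i + m
  else if i ≤ N + l - k then m
  else 0

/-- The combinatorial data behind a critical pair: `r` is the rank function of the second
composition, `c` the common value of `i + n * a i = r i + n * b i`, where `a`, `b` are the quotients
of the two compositions by `m`. -/
structure RankWalk (n p q L : ℕ) (c r : ℕ → ℕ) : Prop where
  two_le : 2 ≤ n
  p_pos : 1 ≤ p
  q_le : q ≤ L
  q_eq : q + 1 = p + n
  c_q : c q + 1 = c p + n
  lt_c_q : L < c q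
  le_c : ∀ x, 1 ≤ x → x ≤ c x
  tail : ∀ x, L < x → c x = x
  step : ∀ x, 1 ≤ x → ∃ w, c (x + 1) + n * w = c x + 1
  p_start : ∀ x, 1 ≤ x → x + 1 = p → c (x + 1) ≠ c x + 1
  q_end : c (q + 1) ≠ c q + 1
  start_le : ∀ x y, 1 ≤ x → x ≤ y → c (y + 1) ≠ c y + 1 → c (y + 1) ≤ c x
  near_end : ∀ x z, 1 ≤ x → x ≤ z → c (z + 1) ≠ c z + 1 → c z < c x + n
  after : ∀ y x, 1 ≤ y → y ≤ x → x ≤ L → c x + 1 < c y + n ∨ (y = p ∧ x = q)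
  before_p : ∀ y, 1 ≤ y → y < p → c p + 2 ≤ c y
  inj : ∀ x y, 1 ≤ x → 1 ≤ y → r x = r y → x = y
  succ : ∀ x, 1 ≤ x → ∃ y, 1 ≤ y ∧ r y = r x + 1
  rel : ∀ x y, 1 ≤ x → 1 ≤ y → r y = r x + 1 →
    (c y = c x + 1 ∧ (x < y ∨ x = p)) ∨ ∃ u, 1 ≤ u ∧ c y + n * u = c x + 1

theorem not_mul_between {n a b : ℕ} (h1 : n * a < n * b) (h2 : n * b < n * a + n) : False := by
  have h3 : a < b := lt_of_mul_lt_mul_left h1 (Nat.zero_le n)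
  have h4 : n * (a + 1) ≤ n * b := Nat.mul_le_mul_left n h3
  rw [Nat.mul_succ] at h4
  omega

theorem eq_add_of_succ_segment {r : ℕ → ℕ} {u v : ℕ} (huv : u ≤ v)
    (h : ∀ z, u ≤ z → z < v → r (z + 1) = r z + 1) : r v = r u + (v - u) := by
  induction v, huv using Nat.le_induction with
  | base => simp
  | succ v hv ih =>
    have := ih fun z h1 h2 => h z h1 (by omega)
    have := h v hv (by omega)
    omega

/-- Induction along increasing `c`, and decreasing index among equal values of `c`. -/
theorem induction_on_level {c : ℕ → ℕ} (hc : ∀ x, 1 ≤ x → x ≤ c x) {P : ℕ → Prop}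
    (h : ∀ x, 1 ≤ x →
      (∀ z, 1 ≤ z → (c z < c x ∨ (c z = c x ∧ x < z)) → P z) → P x) :
    ∀ x, 1 ≤ x → P x := by
  have key : ∀ v d x, 1 ≤ x → c x = v → v - x = d → P x := by
    intro v
    induction v using Nat.strong_induction_on with
    | _ v ihv =>
      intro d
      induction d using Nat.strong_induction_on with
      | _ d ihd =>
        intro x hx hv hd
        refine h x hx fun z hz hzx => ?_
        rcases hzx with hlt | ⟨heq, hlt⟩
        · exact ihv (c z) (by omega) _ z hz rfl rfl
        · have := hc z hz
          exact ihd (v - z) (by omega) z hz (by omega) rfl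
  exact fun x hx => key _ _ x hx rfl rfl

/-- The successor map of the exceptional ranking. -/
def detour (p q X z : ℕ) : ℕ :=
  if z = X then p else if z = q then X + 1 else if z + 1 = p then q + 1 else z + 1

namespace RankWalk

variable {n p q L : ℕ} {c r : ℕ → ℕ}

theorem succ_step (h : RankWalk n p q L c r) {x : ℕ} (hx : 1 ≤ x)
    (ih : ∀ z, 1 ≤ z → (c z < c x ∨ (c z = c x ∧ x < z)) → r (z + 1) = r z + 1)
    (hX : ¬ (x = c q ∧ r p = r x + 1)) : r (x + 1) = r x + 1 := by
  obtain ⟨y, hy1, hy⟩ := h.succ x hx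
  by_contra hne
  have hyx : y ≠ x + 1 := by rintro rfl; exact hne hy
  have taken : ∀ z, 1 ≤ z → z + 1 = y → ¬ (c z < c x ∨ (c z = c x ∧ x < z)) := by
    rintro z hz rfl hb
    have h1 := ih z hz hb
    have h2 := h.inj z x hz hx (by omega)
    omega
  have hqe := h.q_eq
  have hcq := h.c_q
  have hn := h.two_le
  have hp := h.p_pos
  rcases h.rel x y hx hy1 hy with ⟨hc, hlt⟩ | ⟨u, hu, hc⟩
  · by_cases hxy : x < y
    · obtain ⟨z, rfl⟩ : ∃ z, y = z + 1 := ⟨y - 1, by omega⟩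
      by_cases hs : c (z + 1) = c z + 1
      · exact taken z (by omega) rfl (Or.inr ⟨by omega, by omega⟩)
      · have := h.start_le x z hx (by omega) hs
        omega
    · have hxp : x = p := by tauto
      subst hxp
      rcases Nat.lt_or_ge y x with h1 | h1
      · have := h.before_p y hy1 h1
        omega
      · obtain rfl : y = x := by omega
        omega
  · have hnu : n ≤ n * u := Nat.le_mul_of_pos_right n hu
    by_cases hxy : y ≤ x
    · have hseg := eq_add_of_succ_segment (r := r) hxy fun z hz1 hz2 => by
        refine ih z (by omega) (Or.inl ?_)
        rcases Nat.lt_or_ge L z with hz | hz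
        · have h1 := h.tail z hz
          have h2 := h.tail x (by omega)
          omega
        · rcases h.after y z hy1 hz1 hz with h1 | ⟨rfl, rfl⟩
          · omega
          · rcases Nat.lt_or_ge L x with hxL | hxL
            · have h2 := h.tail x hxL
              by_contra h3
              exact hX ⟨by omega, hy⟩
            · rcases h.after y x hy1 hxy hxL with h2 | ⟨-, rfl⟩ <;> omega
      omega
    · obtain ⟨z, rfl⟩ : ∃ z, y = z + 1 := ⟨y - 1, by omega⟩
      by_cases hs : c (z + 1) = c z + 1
      · exact taken z (by omega) rfl (Or.inl (by omega))
      · obtain ⟨w, hw⟩ := h.step z (by omega)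
        have h1 := h.near_end x z hx (by omega) hs
        have h2 : ¬ c z ≤ c x := fun h3 =>
          taken z (by omega) rfl (by omega)
        exact not_mul_between (n := n) (a := u) (b := w) (by omega) (by omega)

theorem detour_step (h : RankWalk n p q L c r) (hb : r p = r (c q) + 1) {x : ℕ} (hx : 1 ≤ x)
    (ih : ∀ z, 1 ≤ z → (c z < c x ∨ (c z = c x ∧ x < z)) →
      r (detour p q (c q) z) = r z + 1)
    (hcx : c q ≤ c x) (hxX : x ≠ c q) : r (detour p q (c q) x) = r x + 1 := by
  obtain ⟨y, hy1, hy⟩ := h.succ x hx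
  by_contra hne
  have hyx : y ≠ detour p q (c q) x := by rintro rfl; exact hne hy
  have taken : ∀ z, 1 ≤ z → (c z < c x ∨ (c z = c x ∧ x < z)) → detour p q (c q) z ≠ y := by
    rintro z hz hb rfl
    have h1 := ih z hz hb
    have h2 := h.inj z x hz hx (by omega)
    subst h2
    omega
  have hqe := h.q_eq
  have hcq := h.c_q
  have hn := h.two_le
  have hp := h.p_pos
  have hqL := h.q_le
  have hLX := h.lt_c_q
  have hcX := h.tail (c q) hLX
  have hcX1 := h.tail (c q + 1) (by omega)
  generalize hXdef : c q = X at *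
  have hyp : y ≠ p := by
    rintro rfl
    exact hxX (h.inj x X hx (by omega) (by omega))
  have dX : detour p q X X = p := by simp [detour]
  have dq : detour p q X q = X + 1 := by
    unfold detour; rw [if_neg (by omega), if_pos rfl]
  have dp : ∀ z, z + 1 = p → detour p q X z = q + 1 := by
    intro z hz
    unfold detour; rw [if_neg (by omega), if_neg (by omega), if_pos hz]
  have dz : ∀ z, z ≠ X → z ≠ q → z + 1 ≠ p → detour p q X z = z + 1 := by
    intro z h1 h2 h3
    unfold detour; rw [if_neg h1, if_neg h2, if_neg h3]
  have segment : ∀ u v, 1 ≤ u → u ≤ v →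
      (∀ z, u ≤ z → z < v → c z < c x ∧ z ≠ X ∧ z ≠ q ∧ z + 1 ≠ p) → r v = r u + (v - u) := by
    intro u v hu huv hz
    refine eq_add_of_succ_segment huv fun z h1 h2 => ?_
    obtain ⟨h3, h4, h5, h6⟩ := hz z h1 h2
    rw [← dz z h4 h5 h6]
    exact ih z (by omega) (Or.inl h3)
  have mid : ∀ z, p ≤ z → z ≤ L → z ≠ q → c z < X := by
    intro z h1 h2 h3
    rcases h.after p z hp h1 h2 with h4 | ⟨-, h4⟩ <;> omega
  rcases h.rel x y hx hy1 hy with ⟨hc, hlt⟩ | ⟨u, hu, hc⟩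
  · have hxy : x < y := by
      rcases hlt with h1 | rfl
      · exact h1
      · omega
    obtain ⟨z, rfl⟩ : ∃ z, y = z + 1 := ⟨y - 1, by omega⟩
    have hs : c (z + 1) = c z + 1 := by
      by_contra hs
      have := h.start_le x z hx (by omega) hs
      omega
    have hzq : z ≠ q := by rintro rfl; exact h.q_end (by omega)
    by_cases hzX : z = X
    · subst hzX
      rcases lt_trichotomy x q with h1 | rfl | h1
      · exact taken q (by omega) (Or.inr ⟨by omega, h1⟩) dq
      · exact hyx dq.symm
      · rcases Nat.lt_or_ge L x with h2 | h2
        · have := h.tail x h2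
          omega
        · have := mid x (by omega) h2 (by omega)
          omega
    · have hd := dz z hzX hzq hyp
      rcases Nat.lt_or_ge x z with h1 | h1
      · exact taken z (by omega) (Or.inr ⟨by omega, h1⟩) hd
      · obtain rfl : x = z := by omega
        exact hyx hd.symm
  · have hnu : n ≤ n * u := Nat.le_mul_of_pos_right n hu
    by_cases hxy : y ≤ x
    · rcases Nat.lt_or_ge L x with hxL | hxL
      · have hcxx := h.tail x hxL
        have low : ∀ z, y ≤ z → z < x → c z < c x := by
          intro z h1 h2
          rcases Nat.lt_or_ge L z with h3 | h3
          · have := h.tail z h3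
            omega
          · rcases h.after y z hy1 h1 h3 with h4 | ⟨h4, -⟩
            · omega
            · exact absurd h4 hyp
        have low' : ∀ z, p ≤ z → z < X → c z < c x ∨ z = q := by
          intro z h1 h2
          rcases Nat.lt_or_ge L z with h3 | h3
          · have := h.tail z h3
            omega
          · by_cases h4 : z = q
            · exact Or.inr h4
            · have := mid z h1 h3 h4
              omega
        rcases Nat.lt_or_ge X y with hyX | hyX
        · have := segment y x hy1 hxy fun z h1 h2 =>
            ⟨low z h1 h2, by omega, by omega, by omega⟩
          omega
        have s1 := segment (X + 1) x (by omega) (by omega) fun z h1 h2 =>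
          ⟨low z (by omega) h2, by omega, by omega, by omega⟩
        have s2 := ih q (by omega) (Or.inl (by omega))
        rw [dq] at s2
        rcases Nat.lt_or_ge q y with hyq | hyq
        · have s3 := segment p q hp (by omega) fun z h1 h2 =>
            ⟨(low' z h1 (by omega)).resolve_right (by omega), by omega, by omega, by omega⟩
          have s4 := segment y X hy1 hyX fun z h1 h2 =>
            ⟨low z h1 (by omega), by omega, by omega, by omega⟩
          omega
        rcases Nat.lt_or_ge y p with hyp' | hyp'
        · have s3 := segment p q hp (by omega) fun z h1 h2 =>
            ⟨(low' z h1 (by omega)).resolve_right (by omega), by omega, by omega, by omega⟩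
          have s4 := segment (q + 1) X (by omega) (by omega) fun z h1 h2 =>
            ⟨low z (by omega) (by omega), by omega, by omega, by omega⟩
          have s5 := segment y (p - 1) hy1 (by omega) fun z h1 h2 =>
            ⟨low z (by omega) (by omega), by omega, by omega, by omega⟩
          have s6 := ih (p - 1) (by omega) (Or.inl (low (p - 1) (by omega) (by omega)))
          rw [dp (p - 1) (by omega)] at s6
          omega
        · have s3 := segment y q hy1 hyq fun z h1 h2 =>
            ⟨low z h1 (by omega), by omega, by omega, by omega⟩
          omega
      · rcases h.after y x hy1 hxy hxL with h1 | ⟨h1, -⟩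
        · omega
        · exact hyp h1
    · obtain ⟨z, rfl⟩ : ∃ z, y = z + 1 := ⟨y - 1, by omega⟩
      by_cases hs : c (z + 1) = c z + 1
      · have hzq : z ≠ q := by rintro rfl; exact h.q_end (by omega)
        by_cases hzX : z = X
        · subst hzX
          exact taken q (by omega) (Or.inl (by omega)) dq
        · exact taken z (by omega) (Or.inl (by omega)) (dz z hzX hzq hyp)
      · obtain ⟨w, hw⟩ := h.step z (by omega)
        have hzX : z ≠ X := by rintro rfl; omega
        have hle : c z ≤ c x := by
          by_contra h2
          have h1 := h.near_end x z hx (by omega) hs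
          exact not_mul_between (n := n) (a := u) (b := w) (by omega) (by omega)
        by_cases hzq : z = q
        · subst hzq
          rcases Nat.lt_or_ge x p with hxp | hxp
          · have hdp := dp (p - 1) (by omega)
            by_cases hxp1 : x = p - 1
            · subst hxp1
              exact hyx hdp.symm
            · have h1 : ¬ c (p - 1) ≤ c x := fun h2 =>
                taken (p - 1) (by omega) (by omega) hdp
              have h2 := h.near_end x (p - 1) hx (by omega)
                (h.p_start (p - 1) (by omega) (by omega))
              obtain ⟨w', hw'⟩ := h.step (p - 1) (by omega)
              rw [Nat.sub_add_cancel hp] at hw'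
              have e1 : n * (u + 1) = n * u + n := Nat.mul_succ n u
              have e2 : n * (w + w') = n * w + n * w' := Nat.mul_add n w w'
              exact not_mul_between (n := n) (a := u + 1) (b := w + w') (by omega) (by omega)
          · have hxz : x = z := by
              by_contra h1
              have := mid x hxp (by omega) h1
              omega
            subst hxz
            have s1 := segment (x + 1) X (by omega) (by omega) fun z h1 h2 => by
              refine ⟨?_, by omega, by omega, by omega⟩
              rcases Nat.lt_or_ge L z with h3 | h3
              · have := h.tail z h3
                omega
              · have := mid z (by omega) h3 (by omega)
                omega
            have s2 := segment p x hp hxp fun z h1 h2 => by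
              have := mid z (by omega) (by omega) (by omega)
              exact ⟨by omega, by omega, by omega, by omega⟩
            omega
        · have hd := dz z hzX hzq hyp
          rcases Nat.lt_or_ge x z with h1 | h1
          · exact taken z (by omega) (by omega) hd
          · obtain rfl : x = z := by omega
            exact hyx hd.symm

theorem succ_or_detour (h : RankWalk n p q L c r) :
    (∀ x, 1 ≤ x → r (x + 1) = r x + 1) ∨
      ∀ x, 1 ≤ x → r (detour p q (c q) x) = r x + 1 := by
  by_cases hb : r p = r (c q) + 1
  · right
    have hp := h.p_pos
    have hqe := h.q_eq
    have hcq := h.c_q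
    have hn := h.two_le
    have low : ∀ x, 1 ≤ x → c x < c q → r (x + 1) = r x + 1 :=
      induction_on_level h.le_c fun x hx ih hlt =>
        h.succ_step hx (fun z hz hzx => ih z hz hzx (by omega)) (by
          rintro ⟨rfl, -⟩
          have := h.tail (c q) h.lt_c_q
          omega)
    refine induction_on_level h.le_c fun x hx ih => ?_
    have hLX := h.lt_c_q
    have hqL := h.q_le
    by_cases hxX : x = c q
    · have : detour p q (c q) x = p := by simp [detour, hxX]
      rw [this, hxX]
      exact hb
    rcases Nat.lt_or_ge (c x) (c q) with hlt | hge
    · have hxq : x ≠ q := by rintro rfl; omega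
      have hxp : x + 1 ≠ p := by
        intro hxp
        obtain ⟨w, hw⟩ := h.step x hx
        have h1 := h.p_start x hx hxp
        have h2 := h.before_p x hx (by omega)
        rw [hxp] at h1 hw
        rcases Nat.eq_zero_or_pos w with rfl | hw0
        · omega
        · have := Nat.le_mul_of_pos_right n hw0
          omega
      have : detour p q (c q) x = x + 1 := by
        unfold detour; rw [if_neg hxX, if_neg hxq, if_neg hxp]
      rw [this]
      exact low x hx hlt
    · exact h.detour_step hb hx ih hge hxX
  · left
    refine induction_on_level h.le_c fun x hx ih => h.succ_step hx ih ?_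
    rintro ⟨rfl, h1⟩
    exact hb h1

end RankWalk

section Rank

variable {M : ℕ} {β : ℕ → ℕ}

theorem rank_eq_card (hβ : ∀ i, M < i → β i = 0) {K i : ℕ} (hK : M ≤ K) (hi : i ≤ K) :
    rank M β i =
      ((Icc 1 K).filter fun j => β i < β j ∨ (β j = β i ∧ j ≤ i)).card := by
  rw [rank, filter_or, card_union_of_disjoint]
  · congr 2
    · ext j
      simp only [mem_filter, mem_Icc]
      constructor
      · rintro ⟨⟨h1, h2⟩, h3⟩
        exact ⟨⟨h1, by omega⟩, h3⟩
      · rintro ⟨⟨h1, h2⟩, h3⟩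
        refine ⟨⟨h1, ?_⟩, h3⟩
        by_contra h4
        have := hβ j (by omega)
        omega
    · ext j
      simp only [mem_filter, mem_Icc]
      constructor
      · rintro ⟨⟨h1, h2⟩, h3⟩
        exact ⟨⟨h1, by omega⟩, h3, h2⟩
      · rintro ⟨⟨h1, h2⟩, h3, h4⟩
        exact ⟨⟨h1, h4⟩, h3⟩
  · rw [disjoint_filter]
    intro j _ h1 h2
    omega

theorem rank_lt_rank (hβ : ∀ i, M < i → β i = 0) {i j : ℕ} (hj : 1 ≤ j)
    (h : β j < β i ∨ (β i = β j ∧ i < j)) : rank M β i < rank M β j := by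
  rw [rank_eq_card hβ (K := max M (max i j)) (by omega) (by omega),
    rank_eq_card hβ (K := max M (max i j)) (by omega) (by omega)]
  refine card_lt_card ⟨fun a => ?_, fun hsub => ?_⟩
  · simp only [mem_filter, mem_Icc]
    omega
  · have := @hsub j (by simp [hj])
    simp only [mem_filter, mem_Icc] at this
    omega

theorem before_of_rank_lt (hβ : ∀ i, M < i → β i = 0) {i j : ℕ} (hi : 1 ≤ i)
    (h : rank M β i < rank M β j) : β j < β i ∨ (β i = β j ∧ i < j) := by
  by_contra hn
  by_cases hij : i = j
  · subst hij
    omega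
  · have := rank_lt_rank hβ hi (i := j) (j := i) (by omega)
    omega

theorem rank_inj (hβ : ∀ i, M < i → β i = 0) {i j : ℕ} (hi : 1 ≤ i) (hj : 1 ≤ j)
    (h : rank M β i = rank M β j) : i = j := by
  by_contra hn
  by_cases hb : β j < β i ∨ (β i = β j ∧ i < j)
  · have := rank_lt_rank hβ hj hb
    omega
  · have := rank_lt_rank hβ hi (i := j) (j := i) (by omega)
    omega

theorem rank_mem_Icc (hβ : ∀ i, M < i → β i = 0) {K i : ℕ} (hK : M ≤ K) (hi : i ∈ Icc 1 K) :
    rank M β i ∈ Icc 1 K := by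
  rw [mem_Icc] at hi
  rw [rank_eq_card hβ hK hi.2, mem_Icc]
  constructor
  · refine card_pos.2 ⟨i, ?_⟩
    simp [hi]
  · exact (card_filter_le _ _).trans (by simp)

theorem exists_rank_eq (hβ : ∀ i, M < i → β i = 0) {v : ℕ} (hv : 1 ≤ v) :
    ∃ i, 1 ≤ i ∧ rank M β i = v := by
  have hinj : Set.InjOn (rank M β) (Icc 1 (max M v) : Finset ℕ) := by
    intro i hi j hj h
    rw [mem_coe, mem_Icc] at hi hj
    exact rank_inj hβ hi.1 hj.1 h
  obtain ⟨i, hi, h⟩ := surjOn_of_injOn_of_card_le (rank M β)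
    (fun i hi => rank_mem_Icc hβ (le_max_left M v) hi) hinj le_rfl
    (show v ∈ ((Icc 1 (max M v) : Finset ℕ) : Set ℕ) by simp [hv])
  rw [mem_coe, mem_Icc] at hi
  exact ⟨i, hi.1, h⟩

theorem rank_of_lt (hβ : ∀ i, M < i → β i = 0) {i : ℕ} (hi : M < i) : rank M β i = i := by
  rw [rank_eq_card hβ hi.le le_rfl, filter_true_of_mem]
  · simp
  · intro j hj
    rw [mem_Icc] at hj
    have := hβ i hi
    omega

theorem rank_eq_of_order (hβ : ∀ i, M < i → β i = 0) {R : ℕ → ℕ} {K : ℕ} (hK : M ≤ K)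
    (hmem : ∀ i ∈ Icc 1 K, R i ∈ Icc 1 K)
    (hinj : ∀ i ∈ Icc 1 K, ∀ j ∈ Icc 1 K, R i = R j → i = j)
    (hord : ∀ i ∈ Icc 1 K, ∀ j ∈ Icc 1 K, R i < R j → β j < β i ∨ (β i = β j ∧ i < j)) :
    ∀ i ∈ Icc 1 K, rank M β i = R i := by
  intro i hi
  have hi' := mem_Icc.1 hi
  have hR := mem_Icc.1 (hmem i hi)
  have hsurj := surjOn_of_injOn_of_card_le (s := Icc 1 K) (t := Icc 1 K) R hmem
    (fun a ha b hb => hinj a ha b hb) le_rfl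
  rw [rank_eq_card hβ hK hi'.2]
  rw [show R i = (Icc 1 (R i)).card by simp]
  refine card_nbij R ?_ ?_ ?_
  · intro j hj
    have hj := mem_filter.1 hj
    rw [mem_coe, mem_Icc]
    refine ⟨(mem_Icc.1 (hmem j hj.1)).1, ?_⟩
    by_contra h
    have := hord i hi j hj.1 (by omega)
    omega
  · intro a ha b hb
    exact hinj a (mem_filter.1 ha).1 b (mem_filter.1 hb).1
  · intro v hv
    rw [mem_coe, mem_Icc] at hv
    obtain ⟨j, hj, rfl⟩ := hsurj (show v ∈ ((Icc 1 K : Finset ℕ) : Set ℕ) by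
      rw [mem_coe, mem_Icc]; omega)
    refine ⟨j, ?_, rfl⟩
    rw [mem_coe, mem_filter]
    refine ⟨hj, ?_⟩
    rcases hv.2.lt_or_eq with h | h
    · have := hord j hj i hi h
      omega
    · have := hinj j hj i hi h
      subst this
      omega

end Rank

theorem sum_Icc_reindex {K : ℕ} {R : ℕ → ℕ} (f : ℕ → ℕ)
    (hmem : ∀ i ∈ Icc 1 K, R i ∈ Icc 1 K)
    (hinj : ∀ i ∈ Icc 1 K, ∀ j ∈ Icc 1 K, R i = R j → i = j) :
    ∑ i ∈ Icc 1 K, f (R i) = ∑ i ∈ Icc 1 K, f i :=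
  sum_nbij R hmem (fun a ha b hb => hinj a ha b hb)
    (surjOn_of_injOn_of_card_le R hmem (fun a ha b hb => hinj a ha b hb) le_rfl)
    fun _ _ => rfl

theorem decRe_eq {M : ℕ} {β τ : ℕ → ℕ} (hmem : ∀ i ∈ Icc 1 M, τ i ∈ Icc 1 M)
    (hinj : ∀ i ∈ Icc 1 M, ∀ j ∈ Icc 1 M, τ i = τ j → i = j)
    (hanti : ∀ i j, 1 ≤ i → i ≤ j → j ≤ M → β (τ j) ≤ β (τ i)) :
    ∀ i ∈ Icc 1 M, decRe M β i = β (τ i) := by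
  intro i hi
  rw [mem_Icc] at hi
  have key : List.insertionSort (· ≥ ·) ((List.range M).map fun j => β (j + 1)) =
      (List.range M).map fun j => β (τ (j + 1)) := by
    refine List.Perm.eq_of_pairwise' (r := (· ≥ ·)) (List.pairwise_insertionSort _ _) ?_ ?_
    · rw [List.pairwise_map]
      refine List.Pairwise.imp_of_mem ?_ (List.pairwise_lt_range (n := M))
      intro a b _ hb hab
      rw [List.mem_range] at hb
      exact hanti (a + 1) (b + 1) (by omega) (by omega) (by omega)
    · refine (List.perm_insertionSort _ _).trans ?_
      have hperm : (List.range M).Perm ((List.range M).map fun j => τ (j + 1) - 1) := by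
        refine List.Perm.symm (List.Subperm.perm_of_length_le ?_ (by simp))
        refine List.Nodup.subperm ?_ ?_
        · refine List.Nodup.map_on ?_ List.nodup_range
          intro a ha b hb hab
          rw [List.mem_range] at ha hb
          have ha' : a + 1 ∈ Icc 1 M := by rw [mem_Icc]; omega
          have hb' : b + 1 ∈ Icc 1 M := by rw [mem_Icc]; omega
          have h1 := mem_Icc.1 (hmem _ ha')
          have h2 := mem_Icc.1 (hmem _ hb')
          have := hinj _ ha' _ hb' (by omega)
          omega
        · intro a ha
          obtain ⟨b, hb, rfl⟩ := List.mem_map.1 ha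
          rw [List.mem_range] at hb ⊢
          have h1 := mem_Icc.1 (hmem (b + 1) (by rw [mem_Icc]; omega))
          omega
      have h2 := hperm.map fun j => β (j + 1)
      rw [List.map_map] at h2
      refine h2.trans (List.Perm.of_eq (List.map_congr_left ?_))
      intro b hb
      rw [List.mem_range] at hb
      have h1 := mem_Icc.1 (hmem (b + 1) (by rw [mem_Icc]; omega))
      simp only [Function.comp]
      rw [Nat.sub_add_cancel h1.1]
  rw [decRe, key, List.getD_eq_getElem _ _ (by simp; omega)]
  simp only [List.getElem_map, List.getElem_range]
  rw [Nat.sub_add_cancel hi.1]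

theorem exists_ne_of_trig {M : ℕ} {α β : ℕ → ℕ} (h : trig M α β) :
    ∃ i ∈ Icc 1 M, α i ≠ β i := by
  by_contra hn
  push Not at hn
  rcases h.2 with ⟨⟨i, -, hi⟩, -⟩ | ⟨-, ⟨i, hiM, hi⟩, -⟩
  · refine hi ?_
    unfold decRe
    congr 2
    refine List.map_congr_left fun j hj => hn _ ?_
    rw [List.mem_range] at hj
    rw [mem_Icc]
    omega
  · exact hi (hn i hiM)

/-- If `β ≤ α` up to some index, `β ≥ α` afterwards and the totals agree, then `α` dominates
`β`. -/
theorem domsWeak_of_crossing {M K : ℕ} {α β : ℕ → ℕ} (htot : psum β M = psum α M)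
    (hlow : ∀ i, 1 ≤ i → i ≤ M → i ≤ K → β i ≤ α i)
    (hhigh : ∀ i, K < i → i ≤ M → α i ≤ β i) :
    domsWeak M α β := by
  intro j hj
  rw [mem_Icc] at hj
  unfold psum at *
  rcases Nat.lt_or_ge K j with hK | hK
  · have hsplit : ∀ f : ℕ → ℕ,
        ∑ i ∈ Icc 1 M, f i = ∑ i ∈ Icc 1 j, f i + ∑ i ∈ Icc (j + 1) M, f i := by
      intro f
      rw [← sum_union]
      · congr 1
        ext i
        simp only [mem_union, mem_Icc]
        omega
      · rw [disjoint_left]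
        intro i
        simp only [mem_Icc]
        omega
    rw [hsplit, hsplit] at htot
    have : ∑ i ∈ Icc (j + 1) M, α i ≤ ∑ i ∈ Icc (j + 1) M, β i := by
      refine sum_le_sum fun i hi => ?_
      rw [mem_Icc] at hi
      exact hhigh i (by omega) hi.2
    omega
  · refine sum_le_sum fun i hi => ?_
    rw [mem_Icc] at hi
    exact hlow i hi.1 (by omega) (by omega)

section Blocks

variable {μ s l ρ m k : ℕ}

theorem block_lex {ρ i i' j j' t t' : ℕ} (hi : i + μ = ρ + j * μ + t) (ht : 1 ≤ t)
    (hi' : i' + μ = ρ + j' * μ + t') (ht' : t' ≤ μ) (hlt : i < i') :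
    j < j' ∨ (j = j' ∧ t < t') := by
  rcases lt_trichotomy j j' with h | h | h
  · exact Or.inl h
  · subst h
    exact Or.inr ⟨rfl, by omega⟩
  · have := Nat.mul_le_mul_right μ h
    rw [Nat.succ_mul] at this
    omega

theorem block_next {ρ i j j' t t' : ℕ} (hi : i + μ = ρ + j * μ + t) (ht : 1 ≤ t) (htμ : t ≤ μ)
    (hi' : i + 1 + μ = ρ + j' * μ + t') (ht' : 1 ≤ t') (ht'μ : t' ≤ μ) :
    (j' = j ∧ t' = t + 1) ∨ (j' = j + 1 ∧ t = μ ∧ t' = 1) := by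
  rcases block_lex hi ht hi' ht'μ (by omega) with h | ⟨h, -⟩
  · right
    have h1 := Nat.mul_le_mul_right μ h
    rw [Nat.succ_mul] at h1
    refine ⟨?_, by omega, by omega⟩
    by_contra h2
    have h3 : j + 2 ≤ j' := by omega
    have h4 := Nat.mul_le_mul_right μ h3
    rw [Nat.add_mul] at h4
    omega
  · subst h
    exact Or.inl ⟨rfl, by omega⟩

theorem Lam1_block (s m : ℕ) (hμ : 1 ≤ μ) (hρμ : ρ ≤ μ) {i : ℕ} (hi : 1 ≤ i)
    (hiL : i ≤ ρ + l * μ) :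
    ∃ j t, i + μ = ρ + j * μ + t ∧ 1 ≤ t ∧ t ≤ μ ∧ j ≤ l ∧
      Lam1 μ s l ρ m i = m * (s + l + 1 - j) := by
  unfold Lam1
  rw [if_neg (by omega)]
  by_cases h : i ≤ ρ
  · rw [if_pos h]
    exact ⟨0, i + μ - ρ, by omega, by omega, by omega, by omega, by simp⟩
  · rw [if_neg h, if_pos hiL]
    have h1 := Nat.div_add_mod (i - ρ - 1) μ
    have h2 := Nat.mod_lt (i - ρ - 1) hμ
    have h3 : (i - ρ - 1) / μ < l := Nat.div_lt_of_lt_mul (by rw [Nat.mul_comm]; omega)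
    refine ⟨(i - ρ - 1) / μ + 1, (i - ρ - 1) % μ + 1, ?_, by omega, by omega, by omega, ?_⟩
    · rw [Nat.succ_mul, Nat.mul_comm _ μ]
      omega
    · congr 1
      omega

theorem Lam1_of_lt {i : ℕ} (hi : ρ + l * μ < i) : Lam1 μ s l ρ m i = 0 := by
  have : ρ ≤ ρ + l * μ := Nat.le_add_right _ _
  unfold Lam1
  rw [if_neg (by omega), if_neg (by omega), if_neg (by omega)]

theorem Lam1_anti (hμ : 1 ≤ μ) (hρμ : ρ ≤ μ) {i j : ℕ} (hi : 1 ≤ i) (hij : i ≤ j) :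
    Lam1 μ s l ρ m j ≤ Lam1 μ s l ρ m i := by
  rcases Nat.lt_or_ge (ρ + l * μ) j with h | h
  · rw [Lam1_of_lt h]
    exact Nat.zero_le _
  rcases hij.lt_or_eq with hlt | rfl
  · obtain ⟨a, t, h1, h2, h3, h4, h5⟩ := Lam1_block (l := l) s m hμ hρμ hi (by omega)
    obtain ⟨a', t', h1', h2', h3', h4', h5'⟩ := Lam1_block (i := j) s m hμ hρμ (by omega) h
    rw [h5, h5']
    have := block_lex h1 h2 h1' h3' hlt
    exact Nat.mul_le_mul_left m (by omega)
  · exact le_rfl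

theorem le_Lam1 (hμ : 1 ≤ μ) (hρμ : ρ ≤ μ) {i : ℕ} (hi : 1 ≤ i) (hiL : i ≤ ρ + l * μ) :
    m ≤ Lam1 μ s l ρ m i := by
  obtain ⟨a, t, h1, h2, h3, h4, h5⟩ := Lam1_block s m hμ hρμ hi hiL
  rw [h5]
  exact Nat.le_mul_of_pos_right m (by omega)

theorem Lam1_drop_of_lt {i j a a' : ℕ}
    (h : Lam1 μ s l ρ m i = m * (s + l + 1 - a))
    (h' : Lam1 μ s l ρ m j = m * (s + l + 1 - a'))
    (ha : a < a') (ha' : a' ≤ l) : Lam1 μ s l ρ m j + m ≤ Lam1 μ s l ρ m i := by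
  rw [h, h']
  have := Nat.mul_le_mul_left m (show s + l + 1 - a' + 1 ≤ s + l + 1 - a by omega)
  rwa [Nat.mul_succ] at this

theorem Lam1_drop (hμ : 1 ≤ μ) (hρμ : ρ ≤ μ) {i j : ℕ} (hi : 1 ≤ i) (hij : i + μ ≤ j)
    (hj : j ≤ ρ + l * μ) : Lam1 μ s l ρ m j + m ≤ Lam1 μ s l ρ m i := by
  obtain ⟨a, t, h1, h2, h3, h4, h5⟩ := Lam1_block (l := l) s m hμ hρμ hi (by omega)
  obtain ⟨a', t', h1', h2', h3', h4', h5'⟩ := Lam1_block s m hμ hρμ (i := j) (by omega) hj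
  refine Lam1_drop_of_lt h5 h5' ?_ h4'
  rcases block_lex h1 h2 h1' h3' (by omega) with h | ⟨rfl, h⟩ <;> omega

theorem Lam1_drop_end (hμ : 1 ≤ μ) (hρ : 1 ≤ ρ) (hρμ : ρ ≤ μ) (hk : k < l) :
    Lam1 μ s l ρ m (ρ + k * μ + 1) + m ≤ Lam1 μ s l ρ m (ρ + k * μ) := by
  have hkl := Nat.mul_le_mul_right μ hk
  rw [Nat.succ_mul] at hkl
  obtain ⟨a, t, h1, h2, h3, h4, h5⟩ :=
    Lam1_block (l := l) s m hμ hρμ (i := ρ + k * μ) (by omega) (by omega)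
  obtain ⟨a', t', h1', h2', h3', h4', h5'⟩ :=
    Lam1_block (l := l) s m hμ hρμ (i := ρ + k * μ + 1) (by omega) (by omega)
  refine Lam1_drop_of_lt h5 h5' ?_ h4'
  rcases block_next h1 h2 h3 h1' h2' h3' with ⟨h, h'⟩ | ⟨h, -⟩
  · subst h
    rcases lt_trichotomy a' k with h | h | h
    · have := Nat.mul_le_mul_right μ h
      rw [Nat.succ_mul] at this
      omega
    · subst h
      omega
    · have := Nat.mul_le_mul_right μ h
      rw [Nat.succ_mul] at this
      omega
  · omega

theorem lamK_self : lamK μ s l ρ m k (ρ + k * μ) = Lam1 μ s l ρ m (ρ + k * μ) - 1 := by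
  simp [lamK]

theorem lamK_of_ne {i : ℕ} (hi : i ≠ ρ + k * μ) :
    lamK μ s l ρ m k i = Lam1 μ s l ρ m i := by
  simp [lamK, hi]

theorem lamK_of_lt {i : ℕ} (hi : ρ + l * μ < i) : lamK μ s l ρ m k i = 0 := by
  unfold lamK
  rw [Lam1_of_lt hi]
  simp

theorem lamK_anti (hμ : 1 ≤ μ) (hρ : 1 ≤ ρ) (hρμ : ρ ≤ μ) (hm : 1 ≤ m) (hk : k < l) {i j : ℕ}
    (hi : 1 ≤ i) (hij : i ≤ j) : lamK μ s l ρ m k j ≤ lamK μ s l ρ m k i := by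
  by_cases hip : i = ρ + k * μ
  · by_cases hjp : j = ρ + k * μ
    · rw [hip, hjp]
    · rw [hip, lamK_self, lamK_of_ne hjp]
      have h1 := Lam1_drop_end (s := s) (m := m) hμ hρ hρμ hk
      have h2 := Lam1_anti (s := s) (m := m) (l := l) hμ hρμ
        (show 1 ≤ ρ + k * μ + 1 by omega) (show _ ≤ j by omega)
      omega
  · rw [lamK_of_ne hip]
    refine le_trans ?_ (Lam1_anti hμ hρμ hi hij)
    unfold lamK
    split_ifs <;> omega

/-- The quotient by `m` of `lamK`, in block coordinates. -/
theorem lamK_block (s : ℕ) (hμ : 1 ≤ μ) (hρμ : ρ ≤ μ) (hm : 1 ≤ m) (hk : k < l) {i : ℕ}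
    (hi : 1 ≤ i) (hiL : i ≤ ρ + l * μ) :
    ∃ j t, i + μ = ρ + j * μ + t ∧ 1 ≤ t ∧ t ≤ μ ∧ j ≤ l ∧
      (i = ρ + k * μ ↔ j = k ∧ t = μ) ∧
      (i = ρ + k * μ → lamK μ s l ρ m k i = m * (s + l - k) + (m - 1)) ∧
      (i ≠ ρ + k * μ → lamK μ s l ρ m k i = m * (s + l + 1 - j)) := by
  obtain ⟨j, t, h1, h2, h3, h4, h5⟩ := Lam1_block s m hμ hρμ hi hiL
  have hiff : i = ρ + k * μ ↔ j = k ∧ t = μ := by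
    constructor
    · intro h
      rcases lt_trichotomy j k with hjk | hjk | hjk
      · have := Nat.mul_le_mul_right μ hjk
        rw [Nat.succ_mul] at this
        omega
      · subst hjk
        exact ⟨rfl, by omega⟩
      · have := Nat.mul_le_mul_right μ hjk
        rw [Nat.succ_mul] at this
        omega
    · rintro ⟨rfl, rfl⟩
      omega
  refine ⟨j, t, h1, h2, h3, h4, hiff, fun h => ?_, fun h => by rw [lamK_of_ne h, h5]⟩
  obtain ⟨rfl, -⟩ := hiff.1 h
  rw [h, lamK_self, ← h, h5, show s + l + 1 - j = s + l - j + 1 by omega, Nat.mul_succ]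
  omega

/-- The common value of `i + (μ + 1) * a` along the ranking. -/
def levelOf (μ s l ρ m k i : ℕ) : ℕ := i + (μ + 1) * (lamK μ s l ρ m k i / m)

theorem levelOf_of_lt {i : ℕ} (hi : ρ + l * μ < i) : levelOf μ s l ρ m k i = i := by
  simp [levelOf, lamK_of_lt hi]

theorem levelOf_block (s : ℕ) (hμ : 1 ≤ μ) (hρμ : ρ ≤ μ) (hm : 1 ≤ m) (hk : k < l) {i : ℕ}
    (hi : 1 ≤ i) (hiL : i ≤ ρ + l * μ) :
    ∃ j t, i + μ = ρ + j * μ + t ∧ 1 ≤ t ∧ t ≤ μ ∧ j ≤ l ∧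
      (i = ρ + k * μ ↔ j = k ∧ t = μ) ∧
      (i = ρ + k * μ → levelOf μ s l ρ m k i + k + 1 + μ = (μ + 1) * (s + l + 1) + ρ) ∧
      (i ≠ ρ + k * μ → levelOf μ s l ρ m k i + j + μ = (μ + 1) * (s + l + 1) + ρ + t) := by
  obtain ⟨j, t, h1, h2, h3, h4, h5, h6, h7⟩ := lamK_block s hμ hρμ hm hk hi hiL
  refine ⟨j, t, h1, h2, h3, h4, h5, fun h => ?_, fun h => ?_⟩
  · have hdiv : lamK μ s l ρ m k i / m = s + l - k := by
      rw [h6 h, Nat.mul_add_div hm, Nat.div_eq_of_lt (by omega), Nat.add_zero]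
    rw [levelOf, hdiv]
    obtain ⟨d, hd⟩ : ∃ d, s + l = k + d := ⟨s + l - k, by omega⟩
    rw [hd, Nat.add_sub_cancel_left, h]
    ring
  · have hdiv : lamK μ s l ρ m k i / m = s + l + 1 - j := by
      rw [h7 h, Nat.mul_div_cancel_left _ hm]
    rw [levelOf, hdiv]
    obtain ⟨d, hd⟩ : ∃ d, s + l + 1 = j + d := ⟨s + l + 1 - j, by omega⟩
    rw [hd, Nat.add_sub_cancel_left]
    linarith

theorem levelOf_end (s : ℕ) (hμ : 1 ≤ μ) (hρ : 1 ≤ ρ) (hρμ : ρ ≤ μ) (hm : 1 ≤ m) (hk : k < l) :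
    levelOf μ s l ρ m k (ρ + k * μ + μ) + k + 1 = (μ + 1) * (s + l + 1) + ρ := by
  have hkl := Nat.mul_le_mul_right μ hk
  rw [Nat.succ_mul] at hkl
  obtain ⟨j, t, h1, h2, h3, h4, h5, h6, h7⟩ :=
    levelOf_block s hμ hρμ hm hk (i := ρ + k * μ + μ) (by omega) (by omega)
  have := h7 (by omega)
  rcases lt_trichotomy j (k + 1) with h | h | h
  · have := Nat.mul_le_mul_right μ (show j ≤ k by omega)
    omega
  · subst h
    rw [Nat.succ_mul] at h1
    omega
  · have := Nat.mul_le_mul_right μ h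
    rw [Nat.succ_mul, Nat.succ_mul] at this
    omega

/-- Either of the two shapes of `levelOf`, in block coordinates. -/
theorem levelOf_cases (s : ℕ) (hμ : 1 ≤ μ) (hρμ : ρ ≤ μ) (hm : 1 ≤ m) (hk : k < l) {i : ℕ}
    (hi : 1 ≤ i) (hiL : i ≤ ρ + l * μ) :
    ∃ j t, i + μ = ρ + j * μ + t ∧ 1 ≤ t ∧ t ≤ μ ∧ j ≤ l ∧
      ((i = ρ + k * μ ∧ j = k ∧ t = μ ∧
          levelOf μ s l ρ m k i + k + 1 + μ = (μ + 1) * (s + l + 1) + ρ) ∨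
        (i ≠ ρ + k * μ ∧ (j ≠ k ∨ t ≠ μ) ∧
          levelOf μ s l ρ m k i + j + μ = (μ + 1) * (s + l + 1) + ρ + t)) := by
  obtain ⟨j, t, h1, h2, h3, h4, h5, h6, h7⟩ := levelOf_block s hμ hρμ hm hk hi hiL
  refine ⟨j, t, h1, h2, h3, h4, ?_⟩
  by_cases h : i = ρ + k * μ
  · exact Or.inl ⟨h, (h5.1 h).1, (h5.1 h).2, h6 h⟩
  · exact Or.inr ⟨h, not_and_or.1 fun h' => h (h5.2 h'), h7 h⟩

theorem levelOf_start_le (s : ℕ) (hμ : 1 ≤ μ) (hρμ : ρ ≤ μ) (hm : 1 ≤ m) (hk : k < l) {x y : ℕ}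
    (hx : 1 ≤ x) (hxy : x ≤ y)
    (hs : levelOf μ s l ρ m k (y + 1) ≠ levelOf μ s l ρ m k y + 1) :
    levelOf μ s l ρ m k (y + 1) ≤ levelOf μ s l ρ m k x := by
  have hW : (μ + 1) * (s + l + 1) + ρ = ρ + l * μ + l + μ + (μ + 1) * s + 1 := by ring
  rcases Nat.lt_or_ge (ρ + l * μ) (y + 1) with h | h
  · rw [levelOf_of_lt h] at hs ⊢
    rcases Nat.lt_or_ge (ρ + l * μ) y with h' | h'
    · rw [levelOf_of_lt h'] at hs
      omega
    · obtain ⟨j, t, -, h2, -, h4, h5⟩ :=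
        levelOf_cases (l := l) s hμ hρμ hm hk hx (by omega)
      generalize (μ + 1) * s = Z at *
      omega
  · obtain ⟨j, t, h1, h2, h3, h4, h5⟩ := levelOf_cases (l := l) s hμ hρμ hm hk hx (by omega)
    obtain ⟨j', t', h1', h2', h3', h4', h5'⟩ :=
      levelOf_cases (l := l) (i := y) s hμ hρμ hm hk (by omega) (by omega)
    obtain ⟨j₂, t₂, g1, g2, g3, g4, g5⟩ :=
      levelOf_cases (l := l) (i := y + 1) s hμ hρμ hm hk (by omega) h
    have e1 := block_next h1' h2' h3' g1 g2 g3
    have e2 := block_lex h1 h2 g1 g3 (by omega)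
    have e3 : x = y ∨ j < j' ∨ (j = j' ∧ t < t') := by
      rcases hxy.lt_or_eq with h | h
      · exact Or.inr (block_lex h1 h2 h1' h3' h)
      · exact Or.inl h
    clear h1 h1' g1 hW
    rcases h5 with h5 | h5 <;> rcases h5' with h5' | h5' <;> rcases g5 with g5 | g5 <;>
      rcases e1 with e1 | e1 <;> omega

theorem levelOf_near_end (s : ℕ) (hμ : 1 ≤ μ) (hρμ : ρ ≤ μ) (hm : 1 ≤ m) (hk : k < l) {x z : ℕ}
    (hx : 1 ≤ x) (hxz : x ≤ z)
    (hs : levelOf μ s l ρ m k (z + 1) ≠ levelOf μ s l ρ m k z + 1) :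
    levelOf μ s l ρ m k z < levelOf μ s l ρ m k x + (μ + 1) := by
  rcases Nat.lt_or_ge (ρ + l * μ) z with h | h
  · rw [levelOf_of_lt h, levelOf_of_lt (h.trans z.lt_succ_self)] at hs
    omega
  rcases hxz.lt_or_eq with hlt | rfl
  swap
  · omega
  obtain ⟨j, t, h1, h2, h3, h4, h5⟩ := levelOf_cases (l := l) s hμ hρμ hm hk hx (by omega)
  obtain ⟨j', t', h1', h2', h3', h4', h5'⟩ :=
    levelOf_cases (l := l) (i := z) s hμ hρμ hm hk (by omega) h
  have e3 := block_lex h1 h2 h1' h3' hlt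
  clear h1 h1'
  rcases h5 with h5 | h5 <;> rcases h5' with h5' | h5' <;> omega

theorem levelOf_after (s : ℕ) (hμ : 1 ≤ μ) (hρμ : ρ ≤ μ) (hm : 1 ≤ m) (hk : k < l) {x y : ℕ}
    (hy : 1 ≤ y) (hyx : y ≤ x) (hxL : x ≤ ρ + l * μ) :
    levelOf μ s l ρ m k x + 1 < levelOf μ s l ρ m k y + (μ + 1) ∨
      (y = ρ + k * μ ∧ x = ρ + k * μ + μ) := by
  rcases hyx.lt_or_eq with hlt | rfl
  swap
  · omega
  obtain ⟨j, t, h1, h2, h3, h4, h5⟩ := levelOf_cases (l := l) s hμ hρμ hm hk hy (by omega)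
  obtain ⟨j', t', h1', h2', h3', h4', h5'⟩ :=
    levelOf_cases (l := l) (i := x) s hμ hρμ hm hk (by omega) hxL
  have e3 := block_lex h1 h2 h1' h3' hlt
  have e4 : x = ρ + k * μ + μ ∨ j' ≠ k + 1 ∨ t' ≠ μ := by
    by_contra hn
    push Not at hn
    obtain ⟨g1, rfl, rfl⟩ := hn
    rw [Nat.succ_mul] at h1'
    omega
  clear h1 h1'
  rcases h5 with h5 | h5 <;> rcases h5' with h5' | h5' <;> omega

theorem rankWalk (hμ : 1 ≤ μ) (hρ : 1 ≤ ρ) (hρμ : ρ ≤ μ) (hm : 1 ≤ m) (hk : k < l) {r : ℕ → ℕ}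
    (hinj : ∀ x y, 1 ≤ x → 1 ≤ y → r x = r y → x = y)
    (hsucc : ∀ x, 1 ≤ x → ∃ y, 1 ≤ y ∧ r y = r x + 1)
    (hrel : ∀ x y, 1 ≤ x → 1 ≤ y → r y = r x + 1 →
      (levelOf μ s l ρ m k y = levelOf μ s l ρ m k x + 1 ∧ (x < y ∨ x = ρ + k * μ)) ∨
        ∃ u, 1 ≤ u ∧ levelOf μ s l ρ m k y + (μ + 1) * u = levelOf μ s l ρ m k x + 1) :
    RankWalk (μ + 1) (ρ + k * μ) (ρ + k * μ + μ) (ρ + l * μ) (levelOf μ s l ρ m k) r := by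
  have hkl := Nat.mul_le_mul_right μ hk
  rw [Nat.succ_mul] at hkl
  have hcq := levelOf_end s hμ hρ hρμ hm hk
  have hW : (μ + 1) * (s + l + 1) + ρ = ρ + l * μ + l + μ + (μ + 1) * s + 1 := by ring
  have hcp : levelOf μ s l ρ m k (ρ + k * μ) + k + 1 + μ = (μ + 1) * (s + l + 1) + ρ := by
    obtain ⟨j, t, h1, h2, h3, h4, h5⟩ :=
      levelOf_cases (l := l) (i := ρ + k * μ) s hμ hρμ hm hk (by omega) (by omega)
    omega
  have hq1 : ρ + k * μ + μ + μ = ρ + (k + 1) * μ + μ := by ring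
  refine
    { two_le := by omega
      p_pos := by omega
      q_le := by omega
      q_eq := by omega
      c_q := by omega
      lt_c_q := ?_
      le_c := fun x _ => Nat.le_add_right _ _
      tail := fun x hx => levelOf_of_lt hx
      step := fun x hx => ?_
      p_start := fun x hx hxp => ?_
      q_end := ?_
      start_le := fun x y hx hxy hs => levelOf_start_le s hμ hρμ hm hk hx hxy hs
      near_end := fun x z hx hxz hs => levelOf_near_end s hμ hρμ hm hk hx hxz hs
      after := fun y x hy hyx hxL => levelOf_after s hμ hρμ hm hk hy hyx hxL
      before_p := fun y hy hyp => ?_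
      inj := hinj
      succ := hsucc
      rel := hrel }
  · generalize (μ + 1) * s = Z at *
    omega
  · have := Nat.div_le_div_right (c := m)
      (lamK_anti (s := s) hμ hρ hρμ hm hk hx (Nat.le_succ x))
    obtain ⟨w, hw⟩ := Nat.exists_eq_add_of_le this
    refine ⟨w, ?_⟩
    rw [levelOf, levelOf, hw]
    ring
  · obtain ⟨j, t, h1, h2, h3, h4, h5⟩ :=
      levelOf_cases (l := l) s hμ hρμ hm hk hx (by omega)
    have := block_lex h1 h2 (i' := ρ + k * μ) (j' := k) (t' := μ) (by omega) le_rfl (by omega)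
    rw [hxp]
    clear hW h1
    omega
  · rcases Nat.lt_or_ge (ρ + k * μ + μ) (ρ + l * μ) with h | h
    · obtain ⟨j, t, h1, h2, h3, h4, h5⟩ :=
        levelOf_cases (l := l) (i := ρ + k * μ + μ + 1) s hμ hρμ hm hk (by omega) (by omega)
      have := block_next hq1 hμ le_rfl h1 h2 h3
      clear hW h1
      omega
    · rw [levelOf_of_lt (by omega)]
      generalize (μ + 1) * s = Z at *
      omega
  · obtain ⟨j, t, h1, h2, h3, h4, h5⟩ := levelOf_cases (l := l) s hμ hρμ hm hk hy (by omega)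
    have := block_lex h1 h2 (i' := ρ + k * μ) (j' := k) (t' := μ) (by omega) le_rfl hyp
    clear hW h1
    omega

end Blocks

/-- The position of row `i` after moving the rows `p, …, q` to the positions up to `X`. -/
def cutRank (n p q X i : ℕ) : ℕ :=
  if i < p then i else if i ≤ q then i + X - q else if i ≤ X then i - n else i

/-- The inverse of `cutRank`. -/
def cutRankInv (n p q X t : ℕ) : ℕ :=
  if t < p then t else if t + n ≤ X then t + n else if t ≤ X then t + q - X else t

/-- `α` is the partition `lam` with part `p` decreased by one, and `β` is obtained by emptying the
rows `p, …, q` and spreading them over the rows `q + 1, …, X`, `m` boxes in each. -/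
structure CutShape (m n p q L X : ℕ) (lam α β : ℕ → ℕ) : Prop where
  m_pos : 1 ≤ m
  two_le : 2 ≤ n
  p_pos : 1 ≤ p
  q_eq : q + 1 = p + n
  q_le : q ≤ L
  le_X : L + n ≤ X
  anti : ∀ i j, 1 ≤ i → i ≤ j → lam j ≤ lam i
  drop : ∀ i j, 1 ≤ i → i + n ≤ j + 1 → j ≤ L → lam j + m ≤ lam i
  le_lam : ∀ i, 1 ≤ i → i ≤ L → m ≤ lam i
  lam_out : ∀ i, L < i → lam i = 0
  lam_mid : ∀ i, p < i → i ≤ q → n * lam i = m * (X - q)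
  lam_p : lam p = lam q + m
  α_p : α p + 1 = lam p
  α_ne : ∀ i, i ≠ p → α i = lam i
  β_lt : ∀ i, 1 ≤ i → i < p → β i = lam i
  β_p : β p + 1 = m
  β_mid : ∀ i, p < i → i ≤ q → β i = 0
  β_up : ∀ i, q < i → i ≤ L → β i = lam i + m
  β_tail : ∀ i, L < i → i ≤ X → β i = m
  β_out : ∀ i, X < i → β i = 0

namespace CutShape

variable {m n p q L X : ℕ} {lam α β : ℕ → ℕ}

theorem cases_β (h : CutShape m n p q L X lam α β) {i : ℕ} (hi : 1 ≤ i) :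
    (i < p ∧ β i = lam i ∧ cutRank n p q X i = i) ∨
    (i = p ∧ β i + 1 = m ∧ cutRank n p q X i + q = i + X) ∨
    (p < i ∧ i ≤ q ∧ β i = 0 ∧ cutRank n p q X i + q = i + X) ∨
    (q < i ∧ i ≤ L ∧ β i = lam i + m ∧ cutRank n p q X i + n = i) ∨
    (L < i ∧ i ≤ X ∧ β i = m ∧ cutRank n p q X i + n = i) ∨
    (X < i ∧ β i = 0 ∧ cutRank n p q X i = i) := by
  have h1 := h.q_eq
  have h2 := h.q_le
  have h3 := h.le_X
  have h4 := h.two_le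
  unfold cutRank
  rcases lt_trichotomy i p with hp | rfl | hp
  · rw [if_pos hp]
    exact Or.inl ⟨hp, h.β_lt i hi hp, rfl⟩
  · rw [if_neg (by omega), if_pos (by omega)]
    exact Or.inr (Or.inl ⟨rfl, h.β_p, by omega⟩)
  · rw [if_neg (by omega)]
    rcases Nat.lt_or_ge q i with hq | hq
    · rw [if_neg (by omega)]
      rcases Nat.lt_or_ge X i with hX | hX
      · have := h.β_out i hX
        rw [if_neg (by omega)]
        omega
      · rw [if_pos hX]
        rcases Nat.lt_or_ge L i with hL | hL
        · have := h.β_tail i hL hX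
          omega
        · have := h.β_up i hq hL
          omega
    · have := h.β_mid i hp hq
      rw [if_pos hq]
      omega

theorem cutRank_mem (h : CutShape m n p q L X lam α β) {K : ℕ} (hK : X ≤ K) :
    ∀ i ∈ Icc 1 K, cutRank n p q X i ∈ Icc 1 K := by
  intro i hi
  rw [mem_Icc] at hi ⊢
  have h1 := h.q_eq
  have h6 := h.two_le
  have h7 := h.p_pos
  have h3 := h.le_X
  have h2 := h.q_le
  have := h.cases_β hi.1
  omega

theorem cutRank_inj (h : CutShape m n p q L X lam α β) {i j : ℕ} (hi : 1 ≤ i) (hj : 1 ≤ j)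
    (hij : cutRank n p q X i = cutRank n p q X j) : i = j := by
  have h1 := h.q_eq
  have h6 := h.two_le
  have h7 := h.p_pos
  have h3 := h.le_X
  have h2 := h.q_le
  have := h.cases_β hi
  have := h.cases_β hj
  omega

theorem cutRankInv_cases (h : CutShape m n p q L X lam α β) (t : ℕ) :
    (t < p ∧ cutRankInv n p q X t = t) ∨
    (p ≤ t ∧ t + n ≤ X ∧ cutRankInv n p q X t = t + n) ∨
    (X < t + n ∧ t ≤ X ∧ cutRankInv n p q X t + X = t + q) ∨
    (X < t ∧ cutRankInv n p q X t = t) := by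
  have h1 := h.q_eq
  have h3 := h.le_X
  have h2 := h.q_le
  unfold cutRankInv
  split_ifs <;> omega

theorem before_of_cutRank_lt (h : CutShape m n p q L X lam α β) {i j : ℕ} (hi : 1 ≤ i)
    (hj : 1 ≤ j) (hij : cutRank n p q X i < cutRank n p q X j) :
    β j < β i ∨ (β i = β j ∧ i < j) := by
  have h1 := h.q_eq
  have h3 := h.le_X
  have h2 := h.q_le
  have h4 := h.m_pos
  have h5 := h.anti i j hi
  have h6 := h.drop i j hi
  have h7 := h.le_lam i hi
  rcases h.cases_β hi with ci | ci | ci | ci | ci | ci <;>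
    rcases h.cases_β hj with cj | cj | cj | cj | cj | cj <;> omega

theorem eqn (h : CutShape m n p q L X lam α β) {i : ℕ} (hi : 1 ≤ i) :
    n * α i + m * i = n * β i + m * cutRank n p q X i := by
  have h1 := h.q_eq
  have h3 := h.le_X
  have h2 := h.q_le
  have h4 := h.two_le
  rcases h.cases_β hi with ⟨c1, c2, c3⟩ | ⟨rfl, c2, c3⟩ | ⟨c1, c1', c2, c3⟩ | ⟨c1, c1', c2, c3⟩ |
    ⟨c1, c1', c2, c3⟩ | ⟨c1, c2, c3⟩
  · rw [c2, c3, h.α_ne i (by omega)]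
  · obtain ⟨d, hd⟩ : ∃ d, X = q + d := ⟨X - q, by omega⟩
    have e1 := h.lam_mid q (by omega) le_rfl
    have e2 : cutRank n i q X i = i + d := by omega
    have e3 : α i = lam q + β i := by
      have := h.α_p
      have := h.lam_p
      omega
    rw [e2, e3, Nat.mul_add, e1, hd, Nat.add_sub_cancel_left]
    ring
  · obtain ⟨d, hd⟩ : ∃ d, X = q + d := ⟨X - q, by omega⟩
    have e1 := h.lam_mid i c1 c1'
    have e2 : cutRank n p q X i = i + d := by omega
    rw [e2, h.α_ne i (by omega), e1, c2, hd, Nat.add_sub_cancel_left]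
    ring
  · rw [h.α_ne i (by omega), c2]
    nth_rewrite 2 [← c3]
    ring
  · rw [h.α_ne i (by omega), h.lam_out i c1, c2]
    nth_rewrite 1 [← c3]
    ring
  · rw [c2, c3, h.α_ne i (by omega), h.lam_out i (by omega)]

theorem α_out (h : CutShape m n p q L X lam α β) {i : ℕ} (hi : L < i) : α i = 0 := by
  have h1 := h.q_eq
  have h2 := h.q_le
  have h3 := h.two_le
  rw [h.α_ne i (by omega), h.lam_out i hi]

theorem α_anti (h : CutShape m n p q L X lam α β) {i j : ℕ} (hi : 1 ≤ i) (hij : i ≤ j) :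
    α j ≤ α i := by
  have h1 := h.q_eq
  have h2 := h.q_le
  have h3 := h.two_le
  have h4 := h.m_pos
  have e1 := h.anti i j hi hij
  have e2 := h.α_p
  have e3 := h.lam_p
  by_cases hip : i = p
  · subst hip
    by_cases hjp : j = i
    · rw [hjp]
    · rw [h.α_ne j hjp]
      rcases Nat.lt_or_ge q j with hj | hj
      · have := h.anti q j (by omega) hj.le
        omega
      · have e4 := h.lam_mid j (by omega) hj
        rw [← h.lam_mid q (by omega) le_rfl] at e4
        have := Nat.eq_of_mul_eq_mul_left (by omega) e4
        omega
  · rw [h.α_ne i hip]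
    by_cases hjp : j = p
    · subst hjp
      omega
    · rwa [h.α_ne j hjp]

theorem psum_eq (h : CutShape m n p q L X lam α β) {K : ℕ} (hK : X ≤ K) :
    psum β K = psum α K := by
  have h1 : ∑ i ∈ Icc 1 K, (n * α i + m * i) =
      ∑ i ∈ Icc 1 K, (n * β i + m * cutRank n p q X i) :=
    sum_congr rfl fun i hi => h.eqn (mem_Icc.1 hi).1
  rw [sum_add_distrib, sum_add_distrib, ← mul_sum, ← mul_sum, ← mul_sum, ← mul_sum,
    sum_Icc_reindex (fun i => i) (h.cutRank_mem hK) fun i hi j hj =>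
      h.cutRank_inj (mem_Icc.1 hi).1 (mem_Icc.1 hj).1] at h1
  have h2 := h.two_le
  exact (Nat.eq_of_mul_eq_mul_left (by omega) (Nat.add_right_cancel h1)).symm

theorem psum_α (h : CutShape m n p q L X lam α β) {K : ℕ} (hK : L ≤ K) :
    psum α K = psum α L := by
  refine (sum_subset (Icc_subset_Icc_right hK) fun i hi hi' => h.α_out ?_).symm
  rw [mem_Icc] at hi hi'
  omega

theorem X_le (h : CutShape m n p q L X lam α β) : X ≤ L + psum α L := by
  have h3 := h.le_X
  have h4 := h.m_pos
  rw [← h.psum_α (show L ≤ X by omega), ← h.psum_eq le_rfl]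
  have h1 : ∑ i ∈ Ioc L X, 1 ≤ ∑ i ∈ Ioc L X, β i := by
    refine sum_le_sum fun i hi => ?_
    rw [mem_Ioc] at hi
    rw [h.β_tail i hi.1 hi.2]
    exact h4
  have h2 : ∑ i ∈ Ioc L X, β i ≤ ∑ i ∈ Icc 1 X, β i := by
    refine sum_le_sum_of_subset fun i hi => ?_
    rw [mem_Ioc] at hi
    rw [mem_Icc]
    omega
  rw [sum_const, Nat.card_Ioc, smul_eq_mul, mul_one] at h1
  rw [psum]
  omega

theorem rank_β (h : CutShape m n p q L X lam α β) {M : ℕ} (hM : X ≤ M) :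
    ∀ i ∈ Icc 1 M, rank M β i = cutRank n p q X i :=
  rank_eq_of_order (fun i hi => h.β_out i (by omega)) le_rfl (h.cutRank_mem hM)
    (fun _ hi _ hj => h.cutRank_inj (mem_Icc.1 hi).1 (mem_Icc.1 hj).1)
    fun _ hi _ hj => h.before_of_cutRank_lt (mem_Icc.1 hi).1 (mem_Icc.1 hj).1

theorem rank_α (h : CutShape m n p q L X lam α β) {M : ℕ} (hM : X ≤ M) :
    ∀ i ∈ Icc 1 M, rank M α i = i := by
  have h3 := h.le_X
  refine rank_eq_of_order (fun i hi => h.α_out (by omega)) le_rfl (fun _ hi => hi)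
    (fun _ _ _ _ e => e) fun i hi j _ hij => ?_
  have := h.α_anti (mem_Icc.1 hi).1 hij.le
  omega

theorem decRe_α (h : CutShape m n p q L X lam α β) (M : ℕ) :
    ∀ i ∈ Icc 1 M, decRe M α i = α i :=
  decRe_eq (τ := fun i => i) (fun _ hi => hi) (fun _ _ _ _ e => e)
    fun _ _ hi hij _ => h.α_anti hi hij

theorem cutRankInv_mem (h : CutShape m n p q L X lam α β) {M : ℕ} (hM : X ≤ M) :
    ∀ i ∈ Icc 1 M, cutRankInv n p q X i ∈ Icc 1 M := by
  intro i hi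
  rw [mem_Icc] at hi ⊢
  have h1 := h.q_eq
  have h3 := h.le_X
  have h2 := h.q_le
  have h4 := h.p_pos
  have := h.cutRankInv_cases i
  omega

theorem cutRankInv_inj (h : CutShape m n p q L X lam α β) {i j : ℕ}
    (hij : cutRankInv n p q X i = cutRankInv n p q X j) : i = j := by
  have h1 := h.q_eq
  have h3 := h.le_X
  have h2 := h.q_le
  have := h.cutRankInv_cases i
  have := h.cutRankInv_cases j
  omega

theorem cutRank_cutRankInv (h : CutShape m n p q L X lam α β) {i : ℕ} (hi : 1 ≤ i) :
    1 ≤ cutRankInv n p q X i ∧ cutRank n p q X (cutRankInv n p q X i) = i := by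
  have h1 := h.q_eq
  have h6 := h.two_le
  have h7 := h.p_pos
  have h3 := h.le_X
  have h2 := h.q_le
  have c := h.cutRankInv_cases i
  have hpos : 1 ≤ cutRankInv n p q X i := by omega
  refine ⟨hpos, ?_⟩
  have := h.cases_β hpos
  omega

theorem decRe_β (h : CutShape m n p q L X lam α β) {M : ℕ} (hM : X ≤ M) :
    ∀ i ∈ Icc 1 M, decRe M β i = β (cutRankInv n p q X i) := by
  refine decRe_eq (h.cutRankInv_mem hM) (fun _ _ _ _ => h.cutRankInv_inj) fun i j hi hij _ => ?_
  rcases hij.lt_or_eq with hlt | rfl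
  · obtain ⟨a1, a2⟩ := h.cutRank_cutRankInv hi
    obtain ⟨b1, b2⟩ := h.cutRank_cutRankInv (hi.trans hij)
    have := h.before_of_cutRank_lt a1 b1 (by omega)
    omega
  · exact le_rfl

theorem β_cutRankInv_le (h : CutShape m n p q L X lam α β) {i : ℕ} (hi : 1 ≤ i) (hiL : i ≤ L) :
    β (cutRankInv n p q X i) ≤ α i := by
  have h1 := h.q_eq
  have h2 := h.q_le
  have h3 := h.le_X
  have h4 := h.m_pos
  have h5 := h.two_le
  have h6 := h.p_pos
  rcases h.cutRankInv_cases i with ⟨c1, c2⟩ | ⟨c1, c2, c3⟩ | c | c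
  · rw [c2, h.β_lt i hi c1, h.α_ne i (by omega)]
  · rw [c3]
    rcases Nat.lt_or_ge L (i + n) with hin | hin
    · rw [h.β_tail _ hin c2]
      by_cases hip : i = p
      · subst hip
        have := h.α_p
        have := h.lam_p
        have := h.le_lam q (by omega) h2
        omega
      · rw [h.α_ne i hip]
        exact h.le_lam i hi hiL
    · rw [h.β_up _ (by omega) hin]
      by_cases hip : i = p
      · subst hip
        have e1 := h.α_p
        have e2 := h.lam_p
        have e3 := h.drop (i + 1) (i + n) (by omega) (by omega) hin
        have e4 := h.lam_mid (i + 1) (by omega) (by omega)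
        rw [← h.lam_mid q (by omega) le_rfl] at e4
        have := Nat.eq_of_mul_eq_mul_left (by omega) e4
        omega
      · rw [h.α_ne i hip]
        exact h.drop i (i + n) hi (by omega) hin
  · omega
  · omega

theorem psum_decRe_β (h : CutShape m n p q L X lam α β) {M : ℕ} (hM : X ≤ M) :
    psum (decRe M β) M = psum β M := by
  unfold psum
  rw [sum_congr rfl (h.decRe_β hM), sum_Icc_reindex β (h.cutRankInv_mem hM)
    fun _ _ _ _ => h.cutRankInv_inj]

theorem psum_decRe_α (h : CutShape m n p q L X lam α β) (M : ℕ) :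
    psum (decRe M α) M = psum α M := by
  unfold psum
  rw [sum_congr rfl (h.decRe_α M)]

theorem doms_α_β (h : CutShape m n p q L X lam α β) {M : ℕ} (hM : X ≤ M) : doms M α β := by
  have h1 := h.q_eq
  have h2 := h.q_le
  have h3 := h.le_X
  have h4 := h.m_pos
  have h5 := h.two_le
  refine ⟨⟨L + 1, mem_Icc.2 (by omega), ?_⟩,
    domsWeak_of_crossing (K := q) (h.psum_eq hM) (fun i hi _ hiq => ?_) fun i hiq _ => ?_⟩
  · rw [h.α_out (by omega), h.β_tail _ (by omega) (by omega)]
    omega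
  · have e1 := h.α_p
    have e2 := h.lam_p
    have e3 := h.α_ne i
    have e4 := h.cases_β hi
    by_cases hip : i = p
    · subst hip
      omega
    · have := e3 hip
      omega
  · have e3 := h.α_ne i (by omega)
    have e4 := h.cases_β (i := i) (by omega)
    have e5 := h.lam_out i
    omega

theorem trig_α_β (h : CutShape m n p q L X lam α β) {M : ℕ} (hM : X ≤ M) : trig M α β := by
  refine ⟨(h.psum_eq hM).symm, ?_⟩
  by_cases he : ∀ i ∈ Icc 1 M, decRe M α i = decRe M β i
  · exact Or.inr ⟨he, h.doms_α_β hM⟩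
  · push Not at he
    refine Or.inl ⟨he, domsWeak_of_crossing (K := L) ?_ (fun i hi hiM hiL => ?_)
      fun i hiL hiM => ?_⟩
    · rw [h.psum_decRe_α, h.psum_decRe_β hM, h.psum_eq hM]
    · rw [h.decRe_α M i (mem_Icc.2 ⟨hi, hiM⟩), h.decRe_β hM i (mem_Icc.2 ⟨hi, hiM⟩)]
      exact h.β_cutRankInv_le hi hiL
    · rw [h.decRe_α M i (mem_Icc.2 ⟨by omega, hiM⟩), h.α_out hiL]
      exact Nat.zero_le _

theorem isCriticalPair_α_β (h : CutShape m n p q L X lam α β) {M : ℕ} (hM : X ≤ M) :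
    isCriticalPair M n m α β := by
  refine ⟨h.trig_α_β hM, fun i hi => ?_⟩
  rw [h.rank_β hM i hi, h.rank_α hM i hi]
  have := h.eqn (mem_Icc.1 hi).1
  zify at this
  linarith

theorem lenOf_β (h : CutShape m n p q L X lam α β) {M : ℕ} (hM : X ≤ M) : lenOf M β = X := by
  have h3 := h.le_X
  have h4 := h.m_pos
  have h5 := h.two_le
  refine le_antisymm (Finset.sup_le fun i hi => ?_) ?_
  · rw [mem_filter] at hi
    by_contra hn
    exact hi.2 (h.β_out i (not_le.1 hn))
  · refine le_sup (f := id) (mem_filter.2 ⟨mem_Icc.2 (by omega), ?_⟩)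
    rw [h.β_tail X (by omega) le_rfl]
    omega

end CutShape

theorem eq_cutRank_of_detour {n p q X M : ℕ} {r : ℕ → ℕ} (hp : 1 ≤ p) (hq : q + 1 = p + n)
    (hn : 2 ≤ n) (hqX : q < X) (htail : ∀ x, M < x → r x = x)
    (hd : ∀ x, 1 ≤ x → r (detour p q X x) = r x + 1) :
    ∀ x, 1 ≤ x → r x = cutRank n p q X x := by
  have hstep : ∀ z, 1 ≤ z → z ≠ X → z ≠ q → z + 1 ≠ p → r (z + 1) = r z + 1 := by
    intro z hz h1 h2 h3
    rw [← hd z hz, detour, if_neg h1, if_neg h2, if_neg h3]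
  have htop : ∀ x, X < x → r x = x := by
    intro x hx
    have h1 := eq_add_of_succ_segment (r := r) (le_max_left x (M + 1)) fun z h1 _ =>
      hstep z (by omega) (by omega) (by omega) (by omega)
    rw [htail _ (lt_max_of_lt_right M.lt_succ_self)] at h1
    omega
  have hrq : r q = X := by
    have h1 := hd q (by omega)
    rw [detour, if_neg hqX.ne, if_pos rfl, htop _ X.lt_succ_self] at h1
    omega
  have hmid : ∀ x, p ≤ x → x ≤ q → r x + (q - x) = X := by
    intro x h1 h2
    rw [← hrq]
    exact (eq_add_of_succ_segment h2 fun z h3 h4 =>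
      hstep z (by omega) (by omega) (by omega) (by omega)).symm
  have hrX : r X + n = X := by
    have h1 := hd X (by omega)
    rw [detour, if_pos rfl] at h1
    have := hmid p le_rfl (by omega)
    omega
  have hup : ∀ x, q < x → x ≤ X → r x + n = x := by
    intro x h1 h2
    have := eq_add_of_succ_segment (r := r) h2 fun z h3 h4 =>
      hstep z (by omega) (by omega) (by omega) (by omega)
    omega
  intro x hx
  unfold cutRank
  split_ifs with h1 h2 h3
  · have h4 := eq_add_of_succ_segment (r := r) (show x ≤ p - 1 by omega) fun z h5 h6 =>
      hstep z (by omega) (by omega) (by omega) (by omega)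
    have h5 := hd (p - 1) (by omega)
    rw [detour, if_neg (by omega), if_neg (by omega), if_pos (by omega)] at h5
    have := hup (q + 1) (by omega) (by omega)
    omega
  · have := hmid x (by omega) h2
    omega
  · have := hup x (by omega) h3
    omega
  · exact htop x (by omega)

theorem mod_eq_and_level_eq {m n a b i r : ℕ} (hm : 1 ≤ m) (hcop : Nat.Coprime m n)
    (h : n * a + m * i = n * b + m * r) :
    a % m = b % m ∧ i + n * (a / m) = r + n * (b / m) := by
  have h1 : a % m = b % m := by
    refine Nat.ModEq.cancel_left_of_coprime (m := m) (c := n) hcop ?_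
    have h2 : (n * a + m * i) % m = (n * b + m * r) % m := by rw [h]
    rwa [Nat.add_mul_mod_self_left, Nat.add_mul_mod_self_left] at h2
  refine ⟨h1, Nat.eq_of_mul_eq_mul_left hm ?_⟩
  rw [← Nat.div_add_mod a m, ← Nat.div_add_mod b m, h1] at h
  linarith

theorem CutShape.eq_of_isCriticalPair {m n p q L X M : ℕ} {lam α β γ : ℕ → ℕ}
    (h : CutShape m n p q L X lam α β)
    (hγ : ∀ i, M < i → γ i = 0) (hαγ : trig M α γ)
    (heq : ∀ i, 1 ≤ i → n * α i + m * i = n * γ i + m * rank M γ i)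
    (hwalk : (∀ x, 1 ≤ x → rank M γ (x + 1) = rank M γ x + 1) ∨
      ∀ x, 1 ≤ x → rank M γ (detour p q X x) = rank M γ x + 1) :
    ∀ i, 1 ≤ i → γ i = β i := by
  have hn := h.two_le
  rcases hwalk with hw | hw
  · exfalso
    obtain ⟨i, hi, hne⟩ := exists_ne_of_trig hαγ
    rw [mem_Icc] at hi
    have h1 := eq_add_of_succ_segment (r := rank M γ) (show i ≤ M + 1 by omega) fun z h2 _ =>
      hw z (by omega)
    rw [rank_of_lt hγ M.lt_succ_self] at h1
    have h2 : rank M γ i = i := by omega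
    have h3 := heq i hi.1
    rw [h2] at h3
    exact hne (Nat.eq_of_mul_eq_mul_left (by omega) (Nat.add_right_cancel h3))
  · intro i hi
    have h1 := eq_cutRank_of_detour h.p_pos h.q_eq hn
      (by have := h.q_le; have := h.le_X; omega) (fun x hx => rank_of_lt hγ hx) hw i hi
    have h2 := heq i hi
    rw [h1, h.eqn hi] at h2
    exact (Nat.eq_of_mul_eq_mul_left (by omega) (Nat.add_right_cancel h2)).symm

section Main

variable {μ s l ρ m k : ℕ}

theorem dvd_Lam1 (i : ℕ) : m ∣ Lam1 μ s l ρ m i := by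
  unfold Lam1
  split_ifs <;> simp

theorem lamK_mod_of_ne {i : ℕ} (hi : i ≠ ρ + k * μ) : lamK μ s l ρ m k i % m = 0 := by
  rw [lamK_of_ne hi]
  exact Nat.mod_eq_zero_of_dvd (dvd_Lam1 i)

/-- The equations of a critical pair make the ranking of `γ` a walk through the levels. -/
theorem rankWalk_of_eqn (hμ : 1 ≤ μ) (hρ : 1 ≤ ρ) (hρμ : ρ ≤ μ) (hm : 1 ≤ m)
    (hcop : Nat.Coprime m (μ + 1)) (hk : k < l) {M : ℕ} {γ : ℕ → ℕ} (hγ : ∀ i, M < i → γ i = 0)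
    (heq : ∀ i, 1 ≤ i →
      (μ + 1) * lamK μ s l ρ m k i + m * i = (μ + 1) * γ i + m * rank M γ i) :
    RankWalk (μ + 1) (ρ + k * μ) (ρ + k * μ + μ) (ρ + l * μ) (levelOf μ s l ρ m k)
      (rank M γ) := by
  refine rankWalk hμ hρ hρμ hm hk (fun x y hx hy => rank_inj hγ hx hy)
    (fun x _ => exists_rank_eq hγ (Nat.succ_pos _)) fun x y hx hy hr => ?_
  obtain ⟨hx1, hx2⟩ := mod_eq_and_level_eq hm hcop (heq x hx)
  obtain ⟨hy1, hy2⟩ := mod_eq_and_level_eq hm hcop (heq y hy)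
  have hb := before_of_rank_lt hγ hx (show rank M γ x < rank M γ y by omega)
  have hdiv : γ y / m ≤ γ x / m := Nat.div_le_div_right (by omega)
  unfold levelOf
  rcases hdiv.lt_or_eq with hlt | hlt
  · obtain ⟨u, hu⟩ := Nat.exists_eq_add_of_lt hlt
    refine Or.inr ⟨u + 1, by omega, ?_⟩
    rw [hx2, hy2, hr, hu]
    ring
  · refine Or.inl ⟨by rw [hx2, hy2, hr, hlt]; ring, ?_⟩
    rcases hb with hb | ⟨-, hb⟩
    · right
      by_contra hne
      rw [lamK_mod_of_ne hne] at hx1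
      have h1 := Nat.div_add_mod (γ x) m
      have h2 := Nat.div_add_mod (γ y) m
      rw [hlt] at h2
      omega
    · exact Or.inl hb

theorem cutShape_betaExp (hμ : 1 ≤ μ) (hρ : 1 ≤ ρ) (hρμ : ρ ≤ μ) (hm : 1 ≤ m) (hk : k < l)
    {N : ℕ} (hN : N = (s + l + 1) * μ + s + ρ) :
    CutShape m (μ + 1) (ρ + k * μ) (ρ + k * μ + μ) (ρ + l * μ) (N + l - k) (Lam1 μ s l ρ m)
      (lamK μ s l ρ m k) (betaExp μ s l ρ m k (ρ + l * μ) N) := by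
  have hkl := Nat.mul_le_mul_right μ hk
  rw [Nat.succ_mul] at hkl
  have hle : ρ + l * μ + (μ + 1) ≤ N + l - k := by
    have : N = ρ + l * μ + μ + s * μ + s := by rw [hN]; ring
    omega
  have hq : ρ + (k + 1) * μ = ρ + k * μ + μ := by ring
  have hmid : ∀ i, ρ + k * μ < i → i ≤ ρ + k * μ + μ →
      Lam1 μ s l ρ m i = m * (s + l - k) := by
    intro i h1 h2
    obtain ⟨j, t, g1, g2, g3, g4, g5⟩ :=
      Lam1_block (l := l) (i := i) s m hμ hρμ (by omega) (by omega)
    have e1 := block_lex (i := ρ + k * μ) (j := k) (t := μ) rfl hμ g1 g3 h1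
    have e2 : j = k + 1 := by
      by_contra hn
      have := Nat.mul_le_mul_right μ (show k + 2 ≤ j by omega)
      rw [Nat.add_mul] at this
      omega
    rw [g5, e2]
    congr 1
    omega
  have hp : Lam1 μ s l ρ m (ρ + k * μ) = m * (s + l - k) + m := by
    have h1 := le_Lam1 (s := s) (l := l) (m := m) hμ hρμ (i := ρ + k * μ) (by omega) (by omega)
    obtain ⟨j, t, g1, g2, g3, g4, g5, g6, g7⟩ :=
      lamK_block (l := l) (i := ρ + k * μ) s hμ hρμ hm hk (by omega) (by omega)
    have h2 := g6 rfl
    rw [lamK_self] at h2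
    omega
  refine
    { m_pos := hm
      two_le := by omega
      p_pos := by omega
      q_eq := by omega
      q_le := by omega
      le_X := hle
      anti := fun i j hi hij => Lam1_anti hμ hρμ hi hij
      drop := fun i j hi hij hj => Lam1_drop hμ hρμ hi (by omega) hj
      le_lam := fun i hi hiL => le_Lam1 hμ hρμ hi hiL
      lam_out := fun i hi => Lam1_of_lt hi
      lam_mid := fun i h1 h2 => ?_
      lam_p := by rw [hp, hmid _ (by omega) le_rfl]
      α_p := by rw [lamK_self]; omega
      α_ne := fun i hi => lamK_of_ne hi
      β_lt := fun i h1 h2 => ?_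
      β_p := ?_
      β_mid := fun i h1 h2 => ?_
      β_up := fun i h1 h2 => ?_
      β_tail := fun i h1 h2 => ?_
      β_out := fun i h1 => ?_ }
  · have : N + l - k - (ρ + k * μ + μ) = (μ + 1) * (s + l - k) := by
      obtain ⟨d, hd⟩ : ∃ d, l = k + d := ⟨l - k, by omega⟩
      subst hd
      rw [show s + (k + d) - k = s + d by omega]
      have : N + (k + d) = (μ + 1) * (s + d) + (ρ + k * μ + μ) + k := by rw [hN]; ring
      omega
    rw [hmid i h1 h2, this]
    ring
  · rw [betaExp, if_neg (by omega), if_pos h2]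
  · rw [betaExp, if_neg (by omega), if_neg (by omega), if_pos rfl]
    omega
  all_goals
    unfold betaExp
    rw [hq]
    split_ifs <;> omega

end Main

/-- for `λ^{(k)} = Λ(μ,s,l,ρ,m) - ε(ρ+kμ)` there is exactly one
`β ∈ ℕ₀^M` such that `(λ^{(k)}, β)` is a `(-m/(μ+1))`-critical pair; it is the
explicitly given `βexp`, which satisfies `ℓ(β) = N+l-k > N`. -/
theorem unique_critical_pair (μ s l ρ m k : ℕ)
    (hμ : 1 ≤ μ) (hl : 1 ≤ l) (hρ1 : 1 ≤ ρ) (hρμ : ρ ≤ μ) (hm : 1 ≤ m)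
    (hgcd : Nat.gcd m (μ + 1) = 1) (hk : k ≤ l - 1)
    (L N M : ℕ) (hL : L = ρ + l * μ) (hN : N = (s + l + 1) * μ + s + ρ)
    (hM : M = L + psum (lamK μ s l ρ m k) L) :
    (∃! β : ℕ → ℕ, (β 0 = 0 ∧ ∀ i, M < i → β i = 0) ∧
      isCriticalPair M (μ + 1) m (lamK μ s l ρ m k) β) ∧
    ((betaExp μ s l ρ m k L N 0 = 0 ∧ ∀ i, M < i → betaExp μ s l ρ m k L N i = 0) ∧
      isCriticalPair M (μ + 1) m (lamK μ s l ρ m k) (betaExp μ s l ρ m k L N)) ∧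
    lenOf M (betaExp μ s l ρ m k L N) = N + l - k ∧ N < N + l - k := by
  have hkl : k < l := by omega
  have h := cutShape_betaExp (s := s) hμ hρ1 hρμ hm hkl hN
  rw [← hL] at h
  have hXM : N + l - k ≤ M := hM ▸ h.X_le
  have hzero : betaExp μ s l ρ m k L N 0 = 0 := if_pos rfl
  have hout : ∀ i, M < i → betaExp μ s l ρ m k L N i = 0 := fun i hi => h.β_out i (by omega)
  have hcrit := h.isCriticalPair_α_β hXM
  refine ⟨⟨_, ⟨⟨hzero, hout⟩, hcrit⟩, ?_⟩, ⟨⟨hzero, hout⟩, hcrit⟩, h.lenOf_β hXM, by omega⟩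
  rintro γ ⟨⟨hγ0, hγ⟩, hαγ, hγeq⟩
  have heq : ∀ i, 1 ≤ i →
      (μ + 1) * lamK μ s l ρ m k i + m * i = (μ + 1) * γ i + m * rank M γ i := by
    intro i hi
    rcases Nat.lt_or_ge M i with hiM | hiM
    · rw [hγ i hiM, rank_of_lt hγ hiM, h.α_out (by omega)]
    · have hmem : i ∈ Icc 1 M := mem_Icc.2 ⟨hi, hiM⟩
      have := hγeq i hmem
      rw [h.rank_α hXM i hmem] at this
      zify
      push_cast at this
      linarith
  have hwalk := (rankWalk_of_eqn hμ hρ1 hρμ hm hgcd hkl hγ heq).succ_or_detour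
  have hend : levelOf μ s l ρ m k (ρ + k * μ + μ) = N + l - k := by
    have h1 := levelOf_end s hμ hρ1 hρμ hm hkl
    have h2 : N + l + 1 = (μ + 1) * (s + l + 1) + ρ := by
      rw [hN]
      ring
    omega
  rw [hend] at hwalk
  funext i
  rcases Nat.eq_zero_or_pos i with rfl | hi
  · rw [hγ0, hzero]
  · exact h.eq_of_isCriticalPair hγ hαγ heq hwalk i hi
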